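/- arXiv:math/0405400 — 3 statements merged into one kernel-verified Lean document; each statement's English description precedes it below -/
import Mathlib

section
/- Let R be a commutative ring with identity. For all sequences x, y : {positive integers} → R and every positive integer n, ∑_{k|n} k·( ∑_{lcm(i,j)=k} gcd(i,j)·x_i·y_j ) = ( ∑_{i|n} i·x_i )·( ∑_{j|n} j·y_j ). Consequently the ghost map φ̃ : Nr(R) → R^{ℕ≥1}, φ̃(x)_n = ∑_{d|n} d·x_d, is a ring homomorphism from the necklace ring into the product ring with componentwise operations. -/
open Finset

/-- The finite set of ordered pairs `(i, j)` of positive integers with `lcm i j = n`. -/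
def lcmPairs (n : ℕ) : Finset (ℕ × ℕ) :=
  (n.divisors ×ˢ n.divisors).filter fun p => Nat.lcm p.1 p.2 = n

/-- Extend a sequence indexed by positive integers to all of `ℕ` by `0`. -/
def seqExt {R : Type*} [Zero R] (x : ℕ+ → R) : ℕ → R :=
  fun n => if h : 0 < n then x ⟨n, h⟩ else 0

/-- The necklace multiplication `(x·y)_n = ∑_{lcm(i,j)=n} gcd(i,j)·x_i·y_j`. -/
def necklaceMul {R : Type*} [CommRing R] (x y : ℕ+ → R) : ℕ+ → R :=
  fun n => ∑ p ∈ lcmPairs (n : ℕ),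
    (Nat.gcd p.1 p.2 : R) * seqExt x p.1 * seqExt y p.2

/-- The ghost map `φ̃(x)_n = ∑_{d|n} d·x_d`. -/
def ghostMap {R : Type*} [CommRing R] (x : ℕ+ → R) : ℕ+ → R :=
  fun n => ∑ d ∈ (n : ℕ).divisors, (d : R) * seqExt x d

/-- For `k ∣ n`, the pairs with lcm `k` can be sought among the pairs of divisors of `n`. -/
theorem lcmPairs_eq_filter_of_dvd {k n : ℕ} (hn : n ≠ 0) (hk : k ∣ n) :
    lcmPairs k = (n.divisors ×ˢ n.divisors).filter fun p => Nat.lcm p.1 p.2 = k := by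
  have hk0 : k ≠ 0 := ne_zero_of_dvd_ne_zero hn hk
  ext ⟨i, j⟩
  simp only [lcmPairs, mem_filter, mem_product, Nat.mem_divisors]
  constructor
  · rintro ⟨⟨⟨hi, -⟩, hj, -⟩, h⟩
    exact ⟨⟨⟨hi.trans hk, hn⟩, hj.trans hk, hn⟩, h⟩
  · rintro ⟨-, rfl⟩
    exact ⟨⟨⟨Nat.dvd_lcm_left i j, hk0⟩, Nat.dvd_lcm_right i j, hk0⟩, rfl⟩

theorem sum_divisors_mul_sum_lcmPairs {R : Type*} [CommRing R] (x y : ℕ → R) {n : ℕ}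
    (hn : n ≠ 0) :
    ∑ k ∈ n.divisors, (k : R) * ∑ p ∈ lcmPairs k, (Nat.gcd p.1 p.2 : R) * x p.1 * y p.2
      = (∑ i ∈ n.divisors, (i : R) * x i) * (∑ j ∈ n.divisors, (j : R) * y j) := by
  have hmaps : ∀ p ∈ n.divisors ×ˢ n.divisors, Nat.lcm p.1 p.2 ∈ n.divisors := by
    intro p hp
    simp only [mem_product, Nat.mem_divisors] at hp ⊢
    exact ⟨Nat.lcm_dvd hp.1.1 hp.2.1, hn⟩
  rw [sum_mul_sum, ← sum_product', ← sum_fiberwise_of_maps_to hmaps]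
  refine sum_congr rfl fun k hk => ?_
  rw [lcmPairs_eq_filter_of_dvd hn (Nat.dvd_of_mem_divisors hk), mul_sum]
  refine sum_congr rfl fun p hp => ?_
  obtain rfl := (mem_filter.mp hp).2
  have h : (Nat.gcd p.1 p.2 : R) * (Nat.lcm p.1 p.2 : R) = p.1 * p.2 := by
    exact_mod_cast congrArg (Nat.cast (R := R)) (Nat.gcd_mul_lcm p.1 p.2)
  linear_combination (x p.1 * y p.2) * h

theorem seqExt_of_pos {R : Type*} [Zero R] (x : ℕ+ → R) {n : ℕ} (hn : 0 < n) :
    seqExt x n = x ⟨n, hn⟩ :=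
  dif_pos hn

theorem seqExt_add {R : Type*} [AddZeroClass R] (x y : ℕ+ → R) (n : ℕ) :
    seqExt (x + y) n = seqExt x n + seqExt y n := by
  by_cases hn : 0 < n
  · simp only [seqExt_of_pos _ hn]
    rfl
  · simp [seqExt, hn]

/-- For all sequences `x, y` and all `n ≥ 1`,
`∑_{k|n} k·( ∑_{lcm(i,j)=k} gcd(i,j)·x_i·y_j ) = ( ∑_{i|n} i·x_i )·( ∑_{j|n} j·y_j )`;
consequently the ghost map carries the necklace multiplication (and the componentwise
addition) to the componentwise ring operations, i.e. it is a ring homomorphism from the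
necklace ring into the product ring. -/
theorem ghost_map_is_ring_hom (R : Type*) [CommRing R] :
    (∀ x y : ℕ → R, ∀ n : ℕ, 0 < n →
      ∑ k ∈ n.divisors, (k : R) *
          ∑ p ∈ lcmPairs k, (Nat.gcd p.1 p.2 : R) * x p.1 * y p.2
        = (∑ i ∈ n.divisors, (i : R) * x i) * (∑ j ∈ n.divisors, (j : R) * y j)) ∧
    (∀ x y : ℕ+ → R, ghostMap (necklaceMul x y) = ghostMap x * ghostMap y) ∧
    (∀ x y : ℕ+ → R, ghostMap (x + y) = ghostMap x + ghostMap y) := by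
  refine ⟨fun x y n hn => sum_divisors_mul_sum_lcmPairs x y hn.ne', fun x y => ?_,
    fun x y => ?_⟩
  · funext n
    refine Eq.trans (sum_congr rfl fun k hk => ?_)
      (sum_divisors_mul_sum_lcmPairs (seqExt x) (seqExt y) n.ne_zero)
    rw [seqExt_of_pos _ (Nat.pos_of_mem_divisors hk)]
    rfl
  · funext n
    simp only [ghostMap, Pi.add_apply, seqExt_add, mul_add, sum_add_distrib]
end

section
/- Let R be a commutative ring with identity. The additive map φ̃ : R^{ℕ≥1} → R^{ℕ≥1} defined by φ̃(x)_n = ∑_{d|n} d·x_d is bijective if and only if every positive integer is a unit in R. -/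
open Finset

theorem seqExt_coe {R : Type*} [Zero R] (x : ℕ+ → R) (n : ℕ+) : seqExt x n = x n :=
  dif_pos n.pos

/-- Möbius inversion for the ghost map. -/
theorem ghostMap_eq_iff {R : Type*} [CommRing R] (x y : ℕ+ → R) :
    ghostMap x = y ↔ ∀ n : ℕ+, ((n : ℕ) : R) * x n =
      ∑ p ∈ (n : ℕ).divisorsAntidiagonal, (ArithmeticFunction.moebius p.1 : R) * seqExt y p.2 := by
  have h := ArithmeticFunction.sum_eq_iff_sum_mul_moebius_eq
    (f := fun d : ℕ => (d : R) * seqExt x d) (g := seqExt y)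
  constructor
  · rintro hxy n
    rw [← seqExt_coe x n]
    refine (h.1 (fun m hm => ?_) n n.pos).symm
    lift m to ℕ+ using hm
    rw [seqExt_coe, ← hxy, ghostMap]
  · intro hx
    funext n
    rw [← seqExt_coe y n]
    refine h.2 (fun m hm => ?_) n n.pos
    lift m to ℕ+ using hm
    rw [seqExt_coe, hx]

theorem isUnit_prime_of_ghostMap_surjective {R : Type*} [CommRing R]
    (h : Function.Surjective (ghostMap (R := R))) {p : ℕ} (hp : p.Prime) : IsUnit (p : R) := by
  obtain ⟨x, hx⟩ := h fun n => if n = 1 then 0 else 1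
  have h₁ : seqExt x 1 = 0 := by simpa [ghostMap] using congrFun hx 1
  have hne : (⟨p, hp.pos⟩ : ℕ+) ≠ 1 := fun he => hp.ne_one (congrArg PNat.val he)
  have h₂ : ghostMap x ⟨p, hp.pos⟩ = 1 := (congrFun hx _).trans (if_neg hne)
  simp only [ghostMap, PNat.mk_coe, hp.sum_divisors, h₁, mul_zero, add_zero] at h₂
  exact IsUnit.of_mul_eq_one _ h₂

/-- The ghost map `φ̃ : R^{ℕ≥1} → R^{ℕ≥1}`, `φ̃(x)_n = ∑_{d|n} d·x_d`, is bijective if and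
only if every positive integer is a unit in `R`. -/
theorem ghost_map_bijective_iff (R : Type*) [CommRing R] :
    Function.Bijective (ghostMap (R := R)) ↔ ∀ n : ℕ, 0 < n → IsUnit (n : R) := by
  constructor
  · rintro ⟨-, hs⟩ n
    induction n using Nat.recOnMul with
    | zero => simp
    | one => simp
    | prime p hp => exact fun _ => isUnit_prime_of_ghostMap_surjective hs hp
    | mul a b ha hb =>
      intro hab
      rw [Nat.cast_mul]
      exact (ha (Nat.pos_of_mul_pos_right hab)).mul (hb (Nat.pos_of_mul_pos_left hab))
  · intro hu
    rw [Function.bijective_iff_existsUnique]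
    intro y
    simp only [ghostMap_eq_iff]
    choose u hu using fun n : ℕ+ => hu n n.pos
    simp only [← hu, ← Units.eq_inv_mul_iff_mul_eq]
    exact ⟨_, fun _ => rfl, fun _ hx => funext hx⟩
end

section
/- Let R be a commutative ring containing ℚ as a subring. For r ∈ R and a positive integer n set M(r,n) = (1/n)·∑_{d|n} μ(d)·r^{n/d}. Then for all r, s ∈ R and every positive integer n, M(r·s, n) = ∑_{lcm(i,j)=n} gcd(i,j)·M(r,i)·M(s,j). -/
open Finset ArithmeticFunction

/-- The necklace polynomial `M(r,n) = (1/n)·∑_{d|n} μ(d)·r^{n/d}` in a ring containing `ℚ`. -/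
noncomputable def neckPoly {R : Type*} [CommRing R] [Algebra ℚ R] (r : R) (n : ℕ) : R :=
  algebraMap ℚ R (1 / (n : ℚ)) *
    ∑ d ∈ n.divisors, ((moebius d : ℤ) : R) * r ^ (n / d)

theorem natCast_mul_neckPoly {R : Type*} [CommRing R] [Algebra ℚ R] (r : R) {n : ℕ}
    (hn : 0 < n) :
    (n : R) * neckPoly r n = ∑ x ∈ n.divisorsAntidiagonal, ((moebius x.1 : ℤ) : R) * r ^ x.2 := by
  have hq : (n : R) * algebraMap ℚ R (1 / (n : ℚ)) = 1 := by
    rw [← map_natCast (algebraMap ℚ R) n, ← map_mul, mul_one_div_cancel (by positivity), map_one]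
  rw [neckPoly, ← mul_assoc, hq, one_mul,
    Nat.sum_divisorsAntidiagonal (fun d e => ((moebius d : ℤ) : R) * r ^ e)]

theorem sum_divisors_natCast_mul_neckPoly {R : Type*} [CommRing R] [Algebra ℚ R] (r : R) {n : ℕ}
    (hn : 0 < n) : ∑ d ∈ n.divisors, (d : R) * neckPoly r d = r ^ n :=
  (sum_eq_iff_sum_mul_moebius_eq (f := fun d => (d : R) * neckPoly r d) (g := fun d => r ^ d)).mpr
    (fun _ hm => (natCast_mul_neckPoly r hm).symm) n hn

theorem mem_lcmPairs {n : ℕ} (hn : 0 < n) {p : ℕ × ℕ} : p ∈ lcmPairs n ↔ p.1.lcm p.2 = n := by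
  simp only [lcmPairs, mem_filter, mem_product, Nat.mem_divisors, and_iff_right_iff_imp]
  rintro rfl
  exact ⟨⟨Nat.dvd_lcm_left _ _, hn.ne'⟩, Nat.dvd_lcm_right _ _, hn.ne'⟩

theorem sum_divisors_sum_lcmPairs {M : Type*} [AddCommMonoid M] (f : ℕ × ℕ → M) {n : ℕ}
    (hn : 0 < n) :
    ∑ d ∈ n.divisors, ∑ p ∈ lcmPairs d, f p = ∑ p ∈ n.divisors ×ˢ n.divisors, f p := by
  rw [← sum_fiberwise_of_maps_to (s := n.divisors ×ˢ n.divisors) (t := n.divisors)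
    (g := fun p => p.1.lcm p.2)]
  · refine sum_congr rfl fun d hd => sum_congr ?_ fun _ _ => rfl
    ext p
    rw [mem_lcmPairs (Nat.pos_of_mem_divisors hd)]
    simp only [mem_filter, mem_product, Nat.mem_divisors, iff_and_self]
    rintro rfl
    have h := Nat.dvd_of_mem_divisors hd
    exact ⟨⟨(Nat.dvd_lcm_left _ _).trans h, hn.ne'⟩, (Nat.dvd_lcm_right _ _).trans h, hn.ne'⟩
  · intro p hp
    simp only [mem_product, Nat.mem_divisors] at hp ⊢
    exact ⟨Nat.lcm_dvd hp.1.1 hp.2.1, hn.ne'⟩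

theorem sum_divisors_natCast_mul_sum_lcmPairs {R : Type*} [CommRing R] [Algebra ℚ R] (r s : R)
    {n : ℕ} (hn : 0 < n) :
    ∑ d ∈ n.divisors, (d : R) *
      ∑ p ∈ lcmPairs d, (Nat.gcd p.1 p.2 : R) * neckPoly r p.1 * neckPoly s p.2 = (r * s) ^ n := by
  rw [mul_pow, ← sum_divisors_natCast_mul_neckPoly r hn, ← sum_divisors_natCast_mul_neckPoly s hn,
    sum_mul_sum, ← sum_product', ← sum_divisors_sum_lcmPairs _ hn]
  refine sum_congr rfl fun d hd => ?_
  rw [mul_sum]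
  refine sum_congr rfl fun p hp => ?_
  have h : (p.1 : R) * p.2 = Nat.gcd p.1 p.2 * d := by
    rw [← (mem_lcmPairs (Nat.pos_of_mem_divisors hd)).mp hp]
    rw [← Nat.cast_mul, ← Nat.cast_mul, Nat.gcd_mul_lcm]
  linear_combination (-neckPoly r p.1 * neckPoly s p.2) * h

/-- For a commutative ring `R` containing `ℚ` as a subring, all `r, s ∈ R` and `n ≥ 1`,
`M(r·s, n) = ∑_{lcm(i,j)=n} gcd(i,j)·M(r,i)·M(s,j)`. -/
theorem neckPoly_mul (R : Type*) [CommRing R] [Algebra ℚ R]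
    (r s : R) (n : ℕ) (hn : 0 < n) :
    neckPoly (r * s) n =
      ∑ p ∈ lcmPairs n, (Nat.gcd p.1 p.2 : R) * neckPoly r p.1 * neckPoly s p.2 := by
  have hu : IsUnit (n : R) := by
    rw [← map_natCast (algebraMap ℚ R) n]
    exact (IsUnit.mk0 (n : ℚ) (by positivity)).map _
  apply hu.mul_left_cancel
  rw [natCast_mul_neckPoly _ hn]
  exact (sum_eq_iff_sum_mul_moebius_eq (f := fun d => (d : R) *
    ∑ p ∈ lcmPairs d, (Nat.gcd p.1 p.2 : R) * neckPoly r p.1 * neckPoly s p.2)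
    (g := fun d => (r * s) ^ d)).mp
    (fun _ hm => sum_divisors_natCast_mul_sum_lcmPairs r s hm) n hn
end
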